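/- Let G = A ∗_C B be an amalgamated product of groups A and B over monomorphisms ∂₁ : C → A and ∂₂ : C → B. Let X be an A-graph, Y a B-graph, x a vertex of X fixed by ∂₁(C), and y a vertex of Y fixed by ∂₂(C). Let Z be the C-pushout of G×_A X and G×_B Y with respect to (the images of) x and y, and regard X and Y as subgraphs of Z via the canonical embeddings. Then for every edge e of X, the A-stabilizer A_e equals the G-stabilizer G_e of e in Z; analogously, for every edge e of Y, B_e = G_e. -/

import Mathlib

open Monoid

/-! ### The amalgamated product of two groups -/

/-- The amalgamated product `G₁ ∗_C G₂` determined by `G₁ ←f₁− C −f₂→ G₂`: the quotient of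
the free product `G₁ ∗ G₂` by the normal closure of the elements `f₁ c · (f₂ c)⁻¹`. -/
abbrev Amal {C G₁ G₂ : Type*} [Group C] [Group G₁] [Group G₂]
    (f₁ : C →* G₁) (f₂ : C →* G₂) : Type _ :=
  Coprod G₁ G₂ ⧸ Subgroup.normalClosure
    {x : Coprod G₁ G₂ | ∃ c : C, x = Coprod.inl (f₁ c) * (Coprod.inr (f₂ c))⁻¹}

/-- The canonical homomorphism `G₁ →* G₁ ∗_C G₂`. -/
def Amal.inl {C G₁ G₂ : Type*} [Group C] [Group G₁] [Group G₂]
    (f₁ : C →* G₁) (f₂ : C →* G₂) : G₁ →* Amal f₁ f₂ :=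
  (QuotientGroup.mk' _).comp Coprod.inl

/-- The canonical homomorphism `G₂ →* G₁ ∗_C G₂`. -/
def Amal.inr {C G₁ G₂ : Type*} [Group C] [Group G₁] [Group G₂]
    (f₁ : C →* G₁) (f₂ : C →* G₂) : G₂ →* Amal f₁ f₂ :=
  (QuotientGroup.mk' _).comp Coprod.inr

/-! ### The induced `G`-set `G ×_A S` along a homomorphism `A →* G` -/

/-- The relation defining `G ×_A S` along `ι : A →* G`: `(g · ι a, s) ~ (g, a • s)`. -/
def IndRelH {A G : Type*} [Group A] [Group G] (ι : A →* G) (S : Type*) [MulAction A S] :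
    G × S → G × S → Prop :=
  fun p q => ∃ a : A, p.1 = q.1 * ι a ∧ q.2 = a • p.2

/-- The induced `G`-set `G ×_A S` along `ι : A →* G`. -/
def IndSetH {A G : Type*} [Group A] [Group G] (ι : A →* G) (S : Type*) [MulAction A S] :
    Type _ :=
  Quot (IndRelH ι S)

/-- The class of a pair `(g, s)` in `G ×_A S`. -/
def IndSetH.mk {A G : Type*} [Group A] [Group G] (ι : A →* G) (S : Type*) [MulAction A S]
    (p : G × S) : IndSetH ι S :=
  Quot.mk _ p

instance {A G : Type*} [Group A] [Group G] (ι : A →* G) (S : Type*) [MulAction A S] :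
    SMul G (IndSetH ι S) :=
  ⟨fun g => Quot.map (fun p => (g * p.1, p.2)) (by
    rintro p q ⟨a, h1, h2⟩
    exact ⟨a, by dsimp only; rw [h1, mul_assoc], h2⟩)⟩

/-- `G` acts on `G ×_A S` by left multiplication on the first factor. -/
instance {A G : Type*} [Group A] [Group G] (ι : A →* G) (S : Type*) [MulAction A S] :
    MulAction G (IndSetH ι S) where
  one_smul := by
    rintro ⟨p⟩
    show IndSetH.mk ι S (1 * p.1, p.2) = IndSetH.mk ι S p
    rw [one_mul]
  mul_smul g h := by
    rintro ⟨p⟩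
    show IndSetH.mk ι S (g * h * p.1, p.2) = IndSetH.mk ι S (g * (h * p.1), p.2)
    rw [mul_assoc]

/-! ### The `C`-pushout of the induced graphs `G ×_A X` and `G ×_B Y` -/

section GraphPushout

variable {C G₁ G₂ : Type*} [Group C] [Group G₁] [Group G₂]
  (f₁ : C →* G₁) (f₂ : C →* G₂)
  {VX VY : Type*} [MulAction G₁ VX] [MulAction G₂ VY]

/-- The identifications defining the `C`-pushout of `G ×_{G₁} X` and `G ×_{G₂} Y` with
respect to `(x, y)`: for every `g ∈ G`, the vertex `g • x` is glued to `g • y`. -/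
def AmalPRel (x : VX) (y : VY) :
    (IndSetH (Amal.inl f₁ f₂) VX ⊕ IndSetH (Amal.inr f₁ f₂) VY) →
    (IndSetH (Amal.inl f₁ f₂) VX ⊕ IndSetH (Amal.inr f₁ f₂) VY) → Prop :=
  fun u v => ∃ g : Amal f₁ f₂,
    u = Sum.inl (IndSetH.mk (Amal.inl f₁ f₂) VX (g, x)) ∧
    v = Sum.inr (IndSetH.mk (Amal.inr f₁ f₂) VY (g, y))

/-- The vertex set of the `C`-pushout of `G ×_{G₁} X` and `G ×_{G₂} Y` w.r.t. `(x, y)`. -/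
def PushV (x : VX) (y : VY) : Type _ :=
  Quot (AmalPRel f₁ f₂ x y)

/-- The quotient map onto the vertex set of the `C`-pushout. -/
def PushV.mk (x : VX) (y : VY)
    (u : IndSetH (Amal.inl f₁ f₂) VX ⊕ IndSetH (Amal.inr f₁ f₂) VY) : PushV f₁ f₂ x y :=
  Quot.mk _ u

instance (x : VX) (y : VY) : SMul (Amal f₁ f₂) (PushV f₁ f₂ x y) :=
  ⟨fun g => Quot.map (fun u => g • u) (by
    rintro u v ⟨h, rfl, rfl⟩
    exact ⟨g * h, rfl, rfl⟩)⟩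

/-- The group `G = G₁ ∗_C G₂` acts on the `C`-pushout. -/
instance (x : VX) (y : VY) : MulAction (Amal f₁ f₂) (PushV f₁ f₂ x y) where
  one_smul := by
    rintro ⟨u⟩
    show PushV.mk f₁ f₂ x y ((1 : Amal f₁ f₂) • u) = PushV.mk f₁ f₂ x y u
    rw [one_smul]
  mul_smul g h := by
    rintro ⟨u⟩
    show PushV.mk f₁ f₂ x y ((g * h) • u) = PushV.mk f₁ f₂ x y (g • h • u)
    rw [mul_smul]

/-- The canonical map `X → Z` (composition `X ↪ G ×_{G₁} X → Z`). -/
def PushV.inX (x : VX) (y : VY) (v : VX) : PushV f₁ f₂ x y :=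
  PushV.mk f₁ f₂ x y (Sum.inl (IndSetH.mk (Amal.inl f₁ f₂) VX (1, v)))

/-- The canonical map `Y → Z` (composition `Y ↪ G ×_{G₂} Y → Z`). -/
def PushV.inY (x : VX) (y : VY) (w : VY) : PushV f₁ f₂ x y :=
  PushV.mk f₁ f₂ x y (Sum.inr (IndSetH.mk (Amal.inr f₁ f₂) VY (1, w)))

/-- The common image `z` of the vertices `x` and `y` in the `C`-pushout. -/
def PushV.basePt (x : VX) (y : VY) : PushV f₁ f₂ x y :=
  PushV.inX f₁ f₂ x y x

/-- The adjacency relation of the `C`-pushout of the graphs `G ×_{G₁} X` and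
`G ×_{G₂} Y`: edges are the edges coming from the copies of `X` and of `Y`. -/
def PushAdj (X : SimpleGraph VX) (Y : SimpleGraph VY) (x : VX) (y : VY) :
    PushV f₁ f₂ x y → PushV f₁ f₂ x y → Prop :=
  fun u v =>
    (∃ (g : Amal f₁ f₂) (a b : VX), X.Adj a b ∧
      u = PushV.mk f₁ f₂ x y (Sum.inl (IndSetH.mk (Amal.inl f₁ f₂) VX (g, a))) ∧
      v = PushV.mk f₁ f₂ x y (Sum.inl (IndSetH.mk (Amal.inl f₁ f₂) VX (g, b)))) ∨
    (∃ (g : Amal f₁ f₂) (a b : VY), Y.Adj a b ∧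
      u = PushV.mk f₁ f₂ x y (Sum.inr (IndSetH.mk (Amal.inr f₁ f₂) VY (g, a))) ∧
      v = PushV.mk f₁ f₂ x y (Sum.inr (IndSetH.mk (Amal.inr f₁ f₂) VY (g, b))))

/-- The `C`-pushout `Z` of the `G`-graphs `G ×_{G₁} X` and `G ×_{G₂} Y` w.r.t. `(x, y)`. -/
def PushGraph (X : SimpleGraph VX) (Y : SimpleGraph VY) (x : VX) (y : VY) :
    SimpleGraph (PushV f₁ f₂ x y) :=
  SimpleGraph.fromRel (PushAdj f₁ f₂ X Y x y)

end GraphPushout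

/-! ### Alternating products -/

section AltProd

variable {C A B K : Type*} [Group C] [Group A] [Group B] [Group K]

/-- Products `b₁ a₁ b₂ ⋯ aₙ₋₁ bₙ` (with `n ≥ 1`) in `K`, where the `aₖ` come from elements of `P`
outside the image of `C`, and the `bₖ` from elements of `Q` outside the image of `C`. -/
inductive AltProd (f₁ : C →* A) (f₂ : C →* B) (i : A →* K) (j : B →* K)
    (P : Subgroup A) (Q : Subgroup B) : K → Prop
  | single {b : B} (hb : b ∈ Q) (hb' : b ∉ f₂.range) : AltProd f₁ f₂ i j P Q (j b)
  | cons {b : B} (hb : b ∈ Q) (hb' : b ∉ f₂.range) {a : A} (ha : a ∈ P) (ha' : a ∉ f₁.range)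
      {g : K} (hg : AltProd f₁ f₂ i j P Q g) : AltProd f₁ f₂ i j P Q (j b * i a * g)

variable {f₁ : C →* A} {f₂ : C →* B} {i : A →* K} {j : B →* K}
  {P : Subgroup A} {Q : Subgroup B}

theorem AltProd.mono {P' : Subgroup A} {Q' : Subgroup B} (hP : P ≤ P') (hQ : Q ≤ Q') {g : K}
    (hg : AltProd f₁ f₂ i j P Q g) : AltProd f₁ f₂ i j P' Q' g := by
  induction hg with
  | single hb hb' => exact .single (hQ hb) hb'
  | cons hb hb' ha ha' _ ih => exact .cons (hQ hb) hb' (hP ha) ha' ih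

theorem AltProd.mul_mul {g g' : K} {a : A} (hg : AltProd f₁ f₂ i j P Q g) (ha : a ∈ P)
    (ha' : a ∉ f₁.range) (hg' : AltProd f₁ f₂ i j P Q g') :
    AltProd f₁ f₂ i j P Q (g * i a * g') := by
  induction hg with
  | single hb hb' => exact .cons hb hb' ha ha' hg'
  | cons hb hb' hc hc' _ ih =>
    rw [mul_assoc, mul_assoc (j _ * i _), ← mul_assoc _ (i a)]
    exact .cons hb hb' hc hc' ih

theorem AltProd.inv {g : K} (hg : AltProd f₁ f₂ i j P Q g) : AltProd f₁ f₂ i j P Q g⁻¹ := by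
  induction hg with
  | single hb hb' =>
    rw [← map_inv]
    exact .single (inv_mem hb) (by rwa [inv_mem_iff])
  | cons hb hb' ha ha' _ ih =>
    rw [mul_inv_rev, mul_inv_rev, ← mul_assoc, ← map_inv, ← map_inv]
    exact ih.mul_mul (inv_mem ha) (by rwa [inv_mem_iff])
      (.single (inv_mem hb) (by rwa [inv_mem_iff]))

/-- The subgroup of `K` generated by the images of `P` and `Q`. -/
def altSubgroup (i : A →* K) (j : B →* K) (P : Subgroup A) (Q : Subgroup B) : Subgroup K :=
  Subgroup.closure (i '' P ∪ j '' Q)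

theorem map_left_mem_altSubgroup {a : A} (ha : a ∈ P) : i a ∈ altSubgroup i j P Q :=
  Subgroup.subset_closure (.inl ⟨a, ha, rfl⟩)

theorem map_right_mem_altSubgroup {b : B} (hb : b ∈ Q) : j b ∈ altSubgroup i j P Q :=
  Subgroup.subset_closure (.inr ⟨b, hb, rfl⟩)

/-- The shape of the elements of `altSubgroup`: elements of `P`, or alternating products with
elements of `P` added on both sides. -/
def HasAltForm (f₁ : C →* A) (f₂ : C →* B) (i : A →* K) (j : B →* K)
    (P : Subgroup A) (Q : Subgroup B) (h : K) : Prop :=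
  (∃ p ∈ P, h = i p) ∨
    ∃ p ∈ P, ∃ q ∈ P, ∃ w, AltProd f₁ f₂ i j P Q w ∧ h = i p * w * i q

theorem HasAltForm.map_left_mul {a : A} {h : K} (ha : a ∈ P)
    (hh : HasAltForm f₁ f₂ i j P Q h) : HasAltForm f₁ f₂ i j P Q (i a * h) := by
  obtain ⟨p, hp, rfl⟩ | ⟨p, hp, q, hq, w, hw, rfl⟩ := hh
  · exact .inl ⟨a * p, mul_mem ha hp, by simp⟩
  · exact .inr ⟨a * p, mul_mem ha hp, q, hq, w, hw, by simp [mul_assoc]⟩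

theorem HasAltForm.map_right_mul (hij : ∀ c, i (f₁ c) = j (f₂ c)) (hP : f₁.range ≤ P)
    (hQ : f₂.range ≤ Q) {b : B} {h : K} (hb : b ∈ Q)
    (hh : HasAltForm f₁ f₂ i j P Q h) : HasAltForm f₁ f₂ i j P Q (j b * h) := by
  by_cases hb' : b ∈ f₂.range
  · obtain ⟨c, rfl⟩ := hb'
    rw [← hij]
    exact hh.map_left_mul (hP ⟨c, rfl⟩)
  obtain ⟨p, hp, rfl⟩ | ⟨p, hp, q, hq, w, hw, rfl⟩ := hh
  · exact .inr ⟨1, one_mem _, p, hp, _, .single hb hb', by simp⟩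
  by_cases hp' : p ∈ f₁.range
  swap
  · exact .inr ⟨1, one_mem _, q, hq, _, .cons hb hb' hp hp' hw, by simp [mul_assoc]⟩
  obtain ⟨c, rfl⟩ := hp'
  cases hw with
  | @single b' hw hw' =>
    by_cases hr : b * f₂ c * b' ∈ f₂.range
    · obtain ⟨d, hd⟩ := hr
      refine .inl ⟨f₁ d * q, mul_mem (hP ⟨d, rfl⟩) hq, ?_⟩
      rw [map_mul, hij, hij, hd]
      simp [mul_assoc]
    · exact .inr ⟨1, one_mem _, q, hq, _,
        .single (mul_mem (mul_mem hb (hQ ⟨c, rfl⟩)) hw) hr, by simp [hij, mul_assoc]⟩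
  | @cons b' hw hw' a ha ha' g hg =>
    by_cases hr : b * f₂ c * b' ∈ f₂.range
    · obtain ⟨d, hd⟩ := hr
      refine .inr ⟨f₁ d * a, mul_mem (hP ⟨d, rfl⟩) ha, q, hq, g, hg, ?_⟩
      rw [map_mul, hij, hij, hd]
      simp [mul_assoc]
    · exact .inr ⟨1, one_mem _, q, hq, _,
        .cons (mul_mem (mul_mem hb (hQ ⟨c, rfl⟩)) hw) hr ha ha' hg, by simp [hij, mul_assoc]⟩

theorem hasAltForm_of_mem_altSubgroup (hij : ∀ c, i (f₁ c) = j (f₂ c)) (hP : f₁.range ≤ P)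
    (hQ : f₂.range ≤ Q) {h : K} (hh : h ∈ altSubgroup i j P Q) :
    HasAltForm f₁ f₂ i j P Q h := by
  induction hh using Subgroup.closure_induction_left with
  | one => exact .inl ⟨1, one_mem _, by simp⟩
  | mul_left g hg h _ ih =>
    obtain ⟨a, ha, rfl⟩ | ⟨b, hb, rfl⟩ := hg
    · exact ih.map_left_mul ha
    · exact ih.map_right_mul hij hP hQ hb
  | inv_mul_cancel g hg h _ ih =>
    obtain ⟨a, ha, rfl⟩ | ⟨b, hb, rfl⟩ := hg
    · rw [← map_inv]
      exact ih.map_left_mul (inv_mem ha)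
    · rw [← map_inv]
      exact ih.map_right_mul hij hP hQ (inv_mem hb)

theorem mem_of_map_left_mem_altSubgroup (hij : ∀ c, i (f₁ c) = j (f₂ c))
    (hi : Function.Injective i) (halt : ∀ g, AltProd f₁ f₂ i j ⊤ ⊤ g → g ∉ i.range)
    (hP : f₁.range ≤ P) (hQ : f₂.range ≤ Q) {a : A} (ha : i a ∈ altSubgroup i j P Q) :
    a ∈ P := by
  obtain ⟨p, hp, h⟩ | ⟨p, hp, q, hq, w, hw, h⟩ := hasAltForm_of_mem_altSubgroup hij hP hQ ha
  · rwa [hi h]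
  · refine (halt w (hw.mono le_top le_top) ⟨p⁻¹ * a * q⁻¹, ?_⟩).elim
    simp [h, mul_assoc]

theorem mem_range_of_mul_mul_mem_altSubgroup (hij : ∀ c, i (f₁ c) = j (f₂ c))
    (halt : ∀ g, AltProd f₁ f₂ i j ⊤ ⊤ g → g ∉ i.range)
    (hP : f₁.range ≤ P) (hQ : f₂.range ≤ Q) {a a' : A} {h : K} (ha : a ∉ P)
    (hh : h ∈ altSubgroup i j P Q) (hh' : i a * h * i a' ∈ altSubgroup i j P Q) :
    h ∈ i.range := by
  obtain ⟨p, -, rfl⟩ | ⟨p, hp, q, -, w, hw, rfl⟩ := hasAltForm_of_mem_altSubgroup hij hP hQ hh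
  · exact ⟨p, rfl⟩
  exfalso
  replace hw := hw.mono le_top le_top
  obtain ⟨p', -, h⟩ | ⟨p', hp', q', -, w', hw', h⟩ := hasAltForm_of_mem_altSubgroup hij hP hQ hh'
  · refine halt w hw ⟨p⁻¹ * a⁻¹ * p' * a'⁻¹ * q⁻¹, ?_⟩
    simp [← h, mul_assoc]
  · have hs : p'⁻¹ * a * p ∉ f₁.range := fun hs => ha <| by
      simpa [mul_assoc] using mul_mem (mul_mem hp' (hP hs)) (inv_mem hp)
    refine halt _ ((hw'.mono le_top le_top).inv.mul_mul (Subgroup.mem_top _) hs hw)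
      ⟨q' * a'⁻¹ * q⁻¹, ?_⟩
    have hw'' : w' = (i p')⁻¹ * (i a * (i p * w * i q) * i a') * (i q')⁻¹ := by
      rw [h]; group
    rw [hw'']
    simp only [map_mul, map_inv]
    group

end AltProd

/-! ### Edge stabilizers in terms of the vertex stabilizers of the pushout -/

/-- `m : VX → V` plays the role of the canonical map from `X` to the pushout; `hm` is the universal
property of the pushout on vertices, for invariant predicates on both of its pieces. -/
theorem edge_stabilizer_eq_image {C A B K : Type*} [Group C] [Group A] [Group B] [Group K]
    {f₁ : C →* A} {f₂ : C →* B} {i : A →* K} {j : B →* K}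
    (hij : ∀ c, i (f₁ c) = j (f₂ c)) (hi : Function.Injective i)
    (halt : ∀ g, AltProd f₁ f₂ i j ⊤ ⊤ g → g ∉ i.range)
    {VX VY V : Type*} [MulAction A VX] [MulAction B VY] [MulAction K V]
    {x : VX} {y : VY} (hx : ∀ c, f₁ c • x = x) (hy : ∀ c, f₂ c • y = y) (m : VX → V)
    (hsmul : ∀ a u, i a • m u = m (a • u))
    (hm : ∀ (p : K → VX → Prop) (q : K → VY → Prop),
      (∀ g a u, p (g * i a) u ↔ p g (a • u)) → (∀ g b w, q (g * j b) w ↔ q g (b • w)) →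
      (∀ g, p g x ↔ q g y) → ∀ g u v, g • m u = m v → p 1 v → p g u)
    {e : Sym2 VX} (he : ¬ e.IsDiag) :
    {g : K | Sym2.map (g • ·) (Sym2.map m e) = Sym2.map m e} =
      i '' {a : A | Sym2.map (a • ·) e = e} := by
  set H := altSubgroup i j (MulAction.stabilizer A x) (MulAction.stabilizer B y)
  have hP : f₁.range ≤ MulAction.stabilizer A x := by rintro _ ⟨c, rfl⟩; exact hx c
  have hQ : f₂.range ≤ MulAction.stabilizer B y := by rintro _ ⟨c, rfl⟩; exact hy c
  have key : ∀ g u v, g • m u = m v → (∃ a, g = i a ∧ a • u = v) ∨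
      ∃ a a' : A, a • x = u ∧ a' • x = v ∧ (i a')⁻¹ * g * i a ∈ H := by
    intro g u v huv
    refine hm (fun g u => (∃ a, g = i a ∧ a • u = v) ∨
      ∃ a a' : A, a • x = u ∧ a' • x = v ∧ (i a')⁻¹ * g * i a ∈ H)
      (fun g w => ∃ (b : B) (a' : A), b • y = w ∧ a' • x = v ∧ (i a')⁻¹ * g * j b ∈ H)
      ?_ ?_ ?_ g u v huv (.inl ⟨1, by simp, by simp⟩)
    · intro g c u
      constructor
      · rintro (⟨a, h, rfl⟩ | ⟨a, a', rfl, rfl, h⟩)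
        · exact .inl ⟨a * c⁻¹, by rw [map_mul, ← h]; simp, by simp [mul_smul]⟩
        · exact .inr ⟨c * a, a', by simp [mul_smul], rfl, by simpa [mul_assoc] using h⟩
      · rintro (⟨a, rfl, rfl⟩ | ⟨a, a', h, rfl, h'⟩)
        · exact .inl ⟨a * c, by simp, by simp [mul_smul]⟩
        · exact .inr ⟨c⁻¹ * a, a', by rw [mul_smul, h, inv_smul_smul], rfl, by simpa [mul_assoc] using h'⟩
    · intro g c w
      constructor
      · rintro ⟨b, a', rfl, rfl, h⟩
        exact ⟨c * b, a', by simp [mul_smul], rfl, by simpa [mul_assoc] using h⟩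
      · rintro ⟨b, a', h, rfl, h'⟩
        exact ⟨c⁻¹ * b, a', by rw [mul_smul, h, inv_smul_smul], rfl, by simpa [mul_assoc] using h'⟩
    · intro g
      constructor
      · rintro (⟨a, rfl, rfl⟩ | ⟨a, a', ha, rfl, h⟩)
        · exact ⟨1, a, by simp, rfl, by simp [one_mem]⟩
        · refine ⟨1, a', by simp, rfl, ?_⟩
          simpa using mul_mem h (inv_mem (map_left_mem_altSubgroup (i := i) (j := j)
            (Q := MulAction.stabilizer B y) (MulAction.mem_stabilizer_iff.2 ha)))
      · rintro ⟨b, a', hb, rfl, h⟩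
        refine .inr ⟨1, a', by simp, rfl, ?_⟩
        simpa using mul_mem h (inv_mem (map_right_mem_altSubgroup (i := i) (j := j)
            (P := MulAction.stabilizer A x) (MulAction.mem_stabilizer_iff.2 hb)))
  have smul_eq : ∀ {a a' : A}, a'⁻¹ * a ∈ MulAction.stabilizer A x → a • x = a' • x := by
    intro a a' h
    rwa [MulAction.mem_stabilizer_iff, mul_smul, inv_smul_eq_iff] at h
  have hinj : Function.Injective m := by
    intro u v h
    obtain ⟨a, ha, rfl⟩ | ⟨a, a', rfl, rfl, h'⟩ := key 1 u v (by rwa [one_smul])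
    · rw [hi (ha.symm.trans (map_one i).symm), one_smul]
    · refine smul_eq (mem_of_map_left_mem_altSubgroup hij hi halt hP hQ ?_)
      simpa using h'
  have mem_range : ∀ {g u u' v v'}, g • m u = m u' → g • m v = m v' → u' ≠ v' → g ∈ i.range := by
    intro g u u' v v' hu hv hne
    obtain ⟨a, rfl, -⟩ | ⟨a, a', rfl, rfl, h⟩ := key g _ _ hu
    · exact ⟨a, rfl⟩
    obtain ⟨b, rfl, -⟩ | ⟨b, b', rfl, rfl, h'⟩ := key g _ _ hv
    · exact ⟨b, rfl⟩
    obtain ⟨c, hc⟩ := mem_range_of_mul_mul_mem_altSubgroup hij halt hP hQ (a := b'⁻¹ * a')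
      (a' := a⁻¹ * b) (fun hs => hne (smul_eq hs)) h (by simpa [mul_assoc] using h')
    exact ⟨a' * c * a⁻¹, by simp [hc, mul_assoc]⟩
  have map_smul : ∀ a : A, Sym2.map (i a • ·) (Sym2.map m e) = Sym2.map m (Sym2.map (a • ·) e) := by
    intro a
    rw [Sym2.map_map, Sym2.map_map]
    exact congrArg (Sym2.map · e) (funext fun u => hsmul a u)
  ext g
  constructor
  · intro hg
    obtain ⟨a, rfl⟩ : g ∈ i.range := by
      induction e using Sym2.ind with | _ u v
      rw [Sym2.mk_isDiag_iff] at he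
      simp only [Set.mem_ofPred_eq, Sym2.map_mk, Sym2.eq_iff] at hg
      obtain ⟨h, h'⟩ | ⟨h, h'⟩ := hg
      · exact mem_range h h' he
      · exact mem_range h h' (Ne.symm he)
    rw [Set.mem_ofPred_eq, map_smul] at hg
    exact ⟨a, Sym2.map.injective hinj hg, rfl⟩
  · rintro ⟨a, ha, rfl⟩
    rw [Set.mem_ofPred_eq] at ha ⊢
    rw [map_smul, ha]

/-! ### Comparison with Mathlib's pushouts of families of groups -/

section Fam

universe u v

/-- Two groups as a family indexed by `Bool`. -/
def BoolFam (A : Type u) (B : Type v) : Bool → Type (max u v)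
  | true => ULift.{v} A
  | false => ULift.{u} B

instance (A : Type u) (B : Type v) [Group A] [Group B] : ∀ b, Group (BoolFam A B b)
  | true => inferInstanceAs (Group (ULift.{v} A))
  | false => inferInstanceAs (Group (ULift.{u} B))

variable {A : Type u} {B : Type v} [Group A] [Group B] {C : Type*} [Group C]

/-- The identification of the first group with a member of the family. -/
def BoolFam.equivTrue : A ≃* BoolFam A B true := (MulEquiv.ulift : ULift.{v} A ≃* A).symm

/-- The identification of the second group with a member of the family. -/
def BoolFam.equivFalse : B ≃* BoolFam A B false := (MulEquiv.ulift : ULift.{u} B ≃* B).symm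

/-- A span of groups as a family of homomorphisms indexed by `Bool`. -/
def BoolFam.hom (f₁ : C →* A) (f₂ : C →* B) : ∀ b, C →* BoolFam A B b
  | true => BoolFam.equivTrue.toMonoidHom.comp f₁
  | false => BoolFam.equivFalse.toMonoidHom.comp f₂

theorem BoolFam.hom_injective {f₁ : C →* A} {f₂ : C →* B} (hf₁ : Function.Injective f₁)
    (hf₂ : Function.Injective f₂) : ∀ b, Function.Injective (BoolFam.hom f₁ f₂ b)
  | true => BoolFam.equivTrue.injective.comp hf₁
  | false => BoolFam.equivFalse.injective.comp hf₂

theorem BoolFam.equivTrue_mem_range {f₁ : C →* A} {f₂ : C →* B} {a : A} :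
    BoolFam.equivTrue a ∈ (BoolFam.hom f₁ f₂ true).range ↔ a ∈ f₁.range :=
  exists_congr fun _ => BoolFam.equivTrue.injective.eq_iff

theorem BoolFam.equivFalse_mem_range {f₁ : C →* A} {f₂ : C →* B} {b : B} :
    BoolFam.equivFalse b ∈ (BoolFam.hom f₁ f₂ false).range ↔ b ∈ f₂.range :=
  exists_congr fun _ => BoolFam.equivFalse.injective.eq_iff

/-- The canonical map from the first group to the pushout of the family. -/
def BoolFam.inl (f₁ : C →* A) (f₂ : C →* B) : A →* PushoutI (BoolFam.hom f₁ f₂) :=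
  (PushoutI.of true).comp BoolFam.equivTrue.toMonoidHom

/-- The canonical map from the second group to the pushout of the family. -/
def BoolFam.inr (f₁ : C →* A) (f₂ : C →* B) : B →* PushoutI (BoolFam.hom f₁ f₂) :=
  (PushoutI.of false).comp BoolFam.equivFalse.toMonoidHom

theorem BoolFam.inl_comp_eq (f₁ : C →* A) (f₂ : C →* B) (c : C) :
    BoolFam.inl f₁ f₂ (f₁ c) = BoolFam.inr f₁ f₂ (f₂ c) :=
  (PushoutI.of_apply_eq_base (BoolFam.hom f₁ f₂) true c).trans
    (PushoutI.of_apply_eq_base (BoolFam.hom f₁ f₂) false c).symm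

theorem exists_word_cons {f₁ : C →* A} {f₂ : C →* B} {s : Bool} {m : BoolFam A B s}
    (hm : m ∉ (BoolFam.hom f₁ f₂ s).range) {w : CoprodI.Word (BoolFam A B)}
    (hw : PushoutI.Reduced (BoolFam.hom f₁ f₂) w) (hs : w.fstIdx ≠ some s) :
    ∃ w' : CoprodI.Word (BoolFam A B), PushoutI.Reduced (BoolFam.hom f₁ f₂) w' ∧
      w'.fstIdx = some s ∧ PushoutI.ofCoprodI (φ := BoolFam.hom f₁ f₂) w'.prod =
        PushoutI.of s m * PushoutI.ofCoprodI w.prod := by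
  have h1 : m ≠ 1 := by rintro rfl; exact hm (one_mem _)
  refine ⟨.cons m w hs h1, ?_, by simp, by simp⟩
  intro g hg
  obtain rfl | hg := List.mem_cons.1 hg
  · exact hm
  · exact hw g hg

theorem AltProd.exists_word {K : Type*} [Group K] {f₁ : C →* A} {f₂ : C →* B} {i : A →* K}
    {j : B →* K} (hij : ∀ c, i (f₁ c) = j (f₂ c)) {F : K →* PushoutI (BoolFam.hom f₁ f₂)}
    (hFi : ∀ a, F (i a) = BoolFam.inl f₁ f₂ a) (hFj : ∀ b, F (j b) = BoolFam.inr f₁ f₂ b)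
    {P : Subgroup A} {Q : Subgroup B} {g : K} (hg : AltProd f₁ f₂ i j P Q g) (a : A) :
    ∃ w : CoprodI.Word (BoolFam A B), PushoutI.Reduced (BoolFam.hom f₁ f₂) w ∧
      w.fstIdx = some false ∧ PushoutI.ofCoprodI w.prod = F (g * i a) := by
  have hempty : PushoutI.Reduced (BoolFam.hom f₁ f₂) .empty := by simp [PushoutI.Reduced]
  have hnone : (CoprodI.Word.empty : CoprodI.Word (BoolFam A B)).fstIdx = none := rfl
  induction hg with
  | @single b _ hb' =>
    by_cases ha : a ∈ f₁.range
    · obtain ⟨c, rfl⟩ := ha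
      have hbc : b * f₂ c ∉ f₂.range := fun h =>
        hb' (by simpa using mul_mem h (inv_mem ⟨c, rfl⟩ : (f₂ c)⁻¹ ∈ f₂.range))
      obtain ⟨w, hw, hws, hwp⟩ := exists_word_cons (s := false)
        (BoolFam.equivFalse_mem_range.not.2 hbc) hempty (by simp [hnone])
      refine ⟨w, hw, hws, ?_⟩
      rw [hwp, hij, ← map_mul, hFj]
      simp [BoolFam.inr]
    · obtain ⟨w, hw, hws, hwp⟩ := exists_word_cons (s := true)
        (BoolFam.equivTrue_mem_range.not.2 ha) hempty (by simp [hnone])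
      obtain ⟨w', hw', hws', hwp'⟩ := exists_word_cons (s := false)
        (BoolFam.equivFalse_mem_range.not.2 hb') hw (by simp [hws])
      refine ⟨w', hw', hws', ?_⟩
      rw [hwp', hwp, map_mul, hFj, hFi]
      simp [BoolFam.inr, BoolFam.inl]
  | @cons b _ hb' d _ hd' g _ ih =>
    obtain ⟨w₀, hw₀, hws₀, hwp₀⟩ := ih
    obtain ⟨w, hw, hws, hwp⟩ := exists_word_cons (s := true)
      (BoolFam.equivTrue_mem_range.not.2 hd') hw₀ (by simp [hws₀])
    obtain ⟨w', hw', hws', hwp'⟩ := exists_word_cons (s := false)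
      (BoolFam.equivFalse_mem_range.not.2 hb') hw (by simp [hws])
    refine ⟨w', hw', hws', ?_⟩
    rw [hwp', hwp, hwp₀, mul_assoc, map_mul F (_ * _), map_mul F (j _), hFj, hFi, mul_assoc]
    rfl

/-- The normal form theorem: an alternating product does not lie in the first group. -/
theorem AltProd.notMem_range {K : Type*} [Group K] {f₁ : C →* A} {f₂ : C →* B}
    (hf₁ : Function.Injective f₁) (hf₂ : Function.Injective f₂) {i : A →* K}
    {j : B →* K} (hij : ∀ c, i (f₁ c) = j (f₂ c)) {F : K →* PushoutI (BoolFam.hom f₁ f₂)}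
    (hFi : ∀ a, F (i a) = BoolFam.inl f₁ f₂ a) (hFj : ∀ b, F (j b) = BoolFam.inr f₁ f₂ b)
    {P : Subgroup A} {Q : Subgroup B} {g : K} (hg : AltProd f₁ f₂ i j P Q g) :
    g ∉ i.range := by
  rintro ⟨a, rfl⟩
  obtain ⟨w, hw, hws, hwp⟩ := hg.exists_word hij hFi hFj a⁻¹
  rw [hw.eq_empty_of_mem_range (BoolFam.hom_injective hf₁ hf₂)
    ⟨1, by rw [hwp, ← map_mul]; simp⟩] at hws
  cases hws

theorem injective_of_comp_eq_inl {K : Type*} [Group K] {f₁ : C →* A} {f₂ : C →* B}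
    (hf₁ : Function.Injective f₁) (hf₂ : Function.Injective f₂) {i : A →* K}
    {F : K →* PushoutI (BoolFam.hom f₁ f₂)} (hFi : ∀ a, F (i a) = BoolFam.inl f₁ f₂ a) :
    Function.Injective i := by
  intro a a' h
  have h' : BoolFam.inl f₁ f₂ a = BoolFam.inl f₁ f₂ a' := by rw [← hFi, h, hFi]
  exact BoolFam.equivTrue.injective
    (PushoutI.of_injective (BoolFam.hom_injective hf₁ hf₂) true h')

end Fam

/-! ### The amalgamated product and the pushout graph -/

theorem Amal.inl_comp_eq {C G₁ G₂ : Type*} [Group C] [Group G₁] [Group G₂]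
    (f₁ : C →* G₁) (f₂ : C →* G₂) (c : C) : Amal.inl f₁ f₂ (f₁ c) = Amal.inr f₁ f₂ (f₂ c) := by
  rw [← mul_inv_eq_one, ← map_inv]
  refine (QuotientGroup.eq_one_iff (Coprod.inl (f₁ c) * Coprod.inr (f₂ c)⁻¹)).2 ?_
  exact Subgroup.subset_normalClosure ⟨c, by rw [map_inv]⟩

theorem Amal.exists_lift {C G₁ G₂ K : Type*} [Group C] [Group G₁] [Group G₂] [Group K]
    {f₁ : C →* G₁} {f₂ : C →* G₂} (k₁ : G₁ →* K) (k₂ : G₂ →* K)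
    (hk : ∀ c, k₁ (f₁ c) = k₂ (f₂ c)) :
    ∃ F : Amal f₁ f₂ →* K, (∀ a, F (Amal.inl f₁ f₂ a) = k₁ a) ∧
      ∀ b, F (Amal.inr f₁ f₂ b) = k₂ b := by
  refine ⟨QuotientGroup.lift _ (Coprod.lift k₁ k₂) (Subgroup.normalClosure_le_normal ?_),
    fun a => Coprod.lift_apply_inl k₁ k₂ a, fun b => Coprod.lift_apply_inr k₁ k₂ b⟩
  rintro _ ⟨c, rfl⟩
  simp [hk]

section PushV

variable {C G₁ G₂ : Type*} [Group C] [Group G₁] [Group G₂] {f₁ : C →* G₁} {f₂ : C →* G₂}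
  {VX VY : Type*} [MulAction G₁ VX] [MulAction G₂ VY] {x : VX} {y : VY}

theorem IndSetH.mk_mul {A G S : Type*} [Group A] [Group G] [MulAction A S] (ι : A →* G)
    (g : G) (a : A) (s : S) : IndSetH.mk ι S (g * ι a, s) = IndSetH.mk ι S (g, a • s) :=
  Quot.sound ⟨a, rfl, rfl⟩

theorem PushV.inl_smul_inX (a : G₁) (u : VX) :
    Amal.inl f₁ f₂ a • PushV.inX f₁ f₂ x y u = PushV.inX f₁ f₂ x y (a • u) := by
  refine congrArg (fun z => PushV.mk f₁ f₂ x y (Sum.inl z)) ?_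
  exact (congrArg (fun g => IndSetH.mk _ VX (g, u)) (by simp)).trans
    (IndSetH.mk_mul (Amal.inl f₁ f₂) 1 a u)

theorem PushV.inr_smul_inY (b : G₂) (w : VY) :
    Amal.inr f₁ f₂ b • PushV.inY f₁ f₂ x y w = PushV.inY f₁ f₂ x y (b • w) := by
  refine congrArg (fun z => PushV.mk f₁ f₂ x y (Sum.inr z)) ?_
  exact (congrArg (fun g => IndSetH.mk _ VY (g, w)) (by simp)).trans
    (IndSetH.mk_mul (Amal.inr f₁ f₂) 1 b w)

/-- Predicates on the vertices of the pushout are pairs of compatible invariant predicates. -/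
theorem PushV.exists_predicate {p : Amal f₁ f₂ → VX → Prop} {q : Amal f₁ f₂ → VY → Prop}
    (hp : ∀ g a u, p (g * Amal.inl f₁ f₂ a) u ↔ p g (a • u))
    (hq : ∀ g b w, q (g * Amal.inr f₁ f₂ b) w ↔ q g (b • w)) (hpq : ∀ g, p g x ↔ q g y) :
    ∃ r : PushV f₁ f₂ x y → Prop, (∀ g u, r (g • PushV.inX f₁ f₂ x y u) ↔ p g u) ∧
      ∀ g w, r (g • PushV.inY f₁ f₂ x y w) ↔ q g w := by
  let r₁ : IndSetH (Amal.inl f₁ f₂) VX → Prop := Quot.lift (fun z => p z.1 z.2) (by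
    rintro ⟨g', u⟩ ⟨g, u'⟩ ⟨a, h, h'⟩
    dsimp only at h h' ⊢
    rw [h, h', hp])
  let r₂ : IndSetH (Amal.inr f₁ f₂) VY → Prop := Quot.lift (fun z => q z.1 z.2) (by
    rintro ⟨g', w⟩ ⟨g, w'⟩ ⟨b, h, h'⟩
    dsimp only at h h' ⊢
    rw [h, h', hq])
  refine ⟨Quot.lift (Sum.elim r₁ r₂) ?_, fun g u => ?_, fun g w => ?_⟩
  · rintro _ _ ⟨g, rfl, rfl⟩
    exact propext (hpq g)
  · change p (g * 1) u ↔ p g u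
    rw [mul_one]
  · change q (g * 1) w ↔ q g w
    rw [mul_one]

end PushV

/-- With `Z` the `C`-pushout of `G ×_A X` and `G ×_B Y` w.r.t. `(x, y)`
and `X`, `Y` regarded as subgraphs of `Z` via the canonical embeddings: for every edge
`e` of `X`, the `A`-stabilizer of `e` equals the `G`-stabilizer of `e` in `Z`;
analogously for the edges of `Y`. -/
theorem pushout_edge_stabilizers
    {C G₁ G₂ : Type*} [Group C] [Group G₁] [Group G₂]
    (f₁ : C →* G₁) (f₂ : C →* G₂)
    (hf₁ : Function.Injective f₁) (hf₂ : Function.Injective f₂)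
    {VX VY : Type*} [MulAction G₁ VX] [MulAction G₂ VY]
    (X : SimpleGraph VX) (Y : SimpleGraph VY)
    (hX : ∀ (g : G₁) (a b : VX), X.Adj a b → X.Adj (g • a) (g • b))
    (hY : ∀ (g : G₂) (a b : VY), Y.Adj a b → Y.Adj (g • a) (g • b))
    (x : VX) (y : VY)
    (hx : ∀ c : C, f₁ c • x = x) (hy : ∀ c : C, f₂ c • y = y) :
    (∀ e ∈ X.edgeSet,
      {g : Amal f₁ f₂ |
          Sym2.map (g • ·) (Sym2.map (PushV.inX f₁ f₂ x y) e) = Sym2.map (PushV.inX f₁ f₂ x y) e} =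
        Amal.inl f₁ f₂ '' {a : G₁ | Sym2.map (a • ·) e = e}) ∧
    (∀ e ∈ Y.edgeSet,
      {g : Amal f₁ f₂ |
          Sym2.map (g • ·) (Sym2.map (PushV.inY f₁ f₂ x y) e) = Sym2.map (PushV.inY f₁ f₂ x y) e} =
        Amal.inr f₁ f₂ '' {b : G₂ | Sym2.map (b • ·) e = e}) := by
  have hij := Amal.inl_comp_eq f₁ f₂
  constructor
  · intro e he
    obtain ⟨F, hFi, hFj⟩ := Amal.exists_lift (BoolFam.inl f₁ f₂) (BoolFam.inr f₁ f₂)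
      (BoolFam.inl_comp_eq f₁ f₂)
    refine edge_stabilizer_eq_image hij (injective_of_comp_eq_inl hf₁ hf₂ hFi)
      (fun g hg => hg.notMem_range hf₁ hf₂ hij hFi hFj) hx hy _ PushV.inl_smul_inX ?_
      (X.not_isDiag_of_mem_edgeSet he)
    intro p q hp hq hpq g u v h h'
    obtain ⟨r, hr, -⟩ := PushV.exists_predicate hp hq hpq
    rwa [← hr, h, ← one_smul (Amal f₁ f₂) (PushV.inX f₁ f₂ x y v), hr]
  · intro e he
    obtain ⟨F, hFi, hFj⟩ := Amal.exists_lift (BoolFam.inr f₂ f₁) (BoolFam.inl f₂ f₁)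
      (fun c => (BoolFam.inl_comp_eq f₂ f₁ c).symm)
    refine edge_stabilizer_eq_image (fun c => (hij c).symm)
      (injective_of_comp_eq_inl hf₂ hf₁ hFj)
      (fun g hg => hg.notMem_range hf₂ hf₁ (fun c => (hij c).symm) hFj hFi) hy hx _
      PushV.inr_smul_inY ?_ (Y.not_isDiag_of_mem_edgeSet he)
    intro p q hp hq hpq g u v h h'
    obtain ⟨r, -, hr⟩ := PushV.exists_predicate hq hp (fun g => (hpq g).symm)
    rwa [← hr, h, ← one_smul (Amal f₁ f₂) (PushV.inY f₁ f₂ x y v), hr]
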